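/- arXiv:2603.28476 — 3 statements merged into one kernel-verified Lean document; each statement's English description precedes it below -/
import Mathlib

section
/- (Theorem 1, empirical form.) Suppose 0 ≤ α ≤ 1 and the threshold λ satisfies the conformal calibration inequality (Q/(Q+1))·R̂ + 1/(Q+1) ≤ α on the calibration set. Then the average empirical risk of the non-adversarial users is bounded above by the effective budget: R̂_nonadv ≤ max{0, α − (K/(Q+1))·r_adv}. -/
/-- (Theorem 1, empirical form.) If `0 ≤ α ≤ 1` and the conformal calibration
inequality `(Q/(Q+1))·R̂ + 1/(Q+1) ≤ α` holds, then the average empirical risk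
of the non-adversarial users is bounded by the effective budget:
`R̂_nonadv ≤ max 0 (α − (K/(Q+1))·r_adv)`. -/
theorem nonadv_risk_le_effective_budget {U : Type*} [DecidableEq U]
    (𝒬 𝒦 : Finset U) (h𝒬 : 𝒬.Nonempty) (h𝒦 : 𝒦 ⊆ 𝒬) (hK : 0 < 𝒦.card)
    (R : U → ℝ) (hR : ∀ u ∈ 𝒬, 0 ≤ R u ∧ R u ≤ 1)
    (α : ℝ) (hα0 : 0 ≤ α) (hα1 : α ≤ 1)
    (hcal : ((𝒬.card : ℝ) / ((𝒬.card : ℝ) + 1)) *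
        ((1 / (𝒬.card : ℝ)) * ∑ u ∈ 𝒬, R u) + 1 / ((𝒬.card : ℝ) + 1) ≤ α) :
    (1 / (𝒬.card : ℝ)) * ∑ u ∈ 𝒬 \ 𝒦, R u ≤
      max 0 (α - ((𝒦.card : ℝ) / ((𝒬.card : ℝ) + 1)) *
        ((1 / (𝒦.card : ℝ)) * ∑ u ∈ 𝒦, R u)) := by
  have hQ : (0 : ℝ) < (𝒬.card : ℝ) := by exact_mod_cast h𝒬.card_pos
  have hK' : (0 : ℝ) < (𝒦.card : ℝ) := by exact_mod_cast hK
  have hsplit := Finset.sum_sdiff (f := R) h𝒦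
  have hN : ∑ u ∈ 𝒬 \ 𝒦, R u ≤ (𝒬.card : ℝ) := by
    calc ∑ u ∈ 𝒬 \ 𝒦, R u ≤ ∑ u ∈ 𝒬 \ 𝒦, (1 : ℝ) :=
          Finset.sum_le_sum fun u hu => (hR u (Finset.mem_sdiff.mp hu).1).2
      _ = ((𝒬 \ 𝒦).card : ℝ) := by simp
      _ ≤ (𝒬.card : ℝ) := by exact_mod_cast Finset.card_le_card Finset.sdiff_subset
  apply le_max_of_le_right
  rw [← hsplit] at hcal
  generalize ∑ u ∈ 𝒬 \ 𝒦, R u = N at *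
  generalize ∑ u ∈ 𝒦, R u = A at *
  generalize (𝒬.card : ℝ) = q at *
  generalize (𝒦.card : ℝ) = k at *
  have h1 : q / (q + 1) * (1 / q * (N + A)) + 1 / (q + 1)
      = (N + 1) / (q + 1) + A / (q + 1) := by
    field_simp
    ring
  have h2 : k / (q + 1) * (1 / k * A) = A / (q + 1) := by
    field_simp
  have h3 : 1 / q * N ≤ (N + 1) / (q + 1) := by
    rw [one_div_mul_eq_div, div_le_div_iff₀ hQ (by linarith)]
    nlinarith
  rw [h1] at hcal
  rw [h2]
  linarith
end

section
/- Suppose the threshold λ satisfies the conformal calibration inequality (Q/(Q+1))·R̂ + 1/(Q+1) ≤ α. Then the non-adversarial empirical risk satisfies the sharper bound R̂_nonadv ≤ ((Q+1)·α − 1 − K·r_adv)/Q, which is at most α − (K/(Q+1))·r_adv whenever α ≤ 1 and r_adv ≥ 0. -/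
/-- Under the conformal calibration inequality, the non-adversarial empirical
risk satisfies the sharper bound `R̂_nonadv ≤ ((Q+1)·α − 1 − K·r_adv)/Q`,
which is at most `α − (K/(Q+1))·r_adv` whenever `α ≤ 1` and `r_adv ≥ 0`. -/
theorem nonadv_risk_sharper_bound {U : Type*} [DecidableEq U]
    (𝒬 𝒦 : Finset U) (h𝒬 : 𝒬.Nonempty) (h𝒦 : 𝒦 ⊆ 𝒬) (hK : 0 < 𝒦.card)
    (R : U → ℝ) (hR : ∀ u ∈ 𝒬, 0 ≤ R u ∧ R u ≤ 1) (α : ℝ)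
    (hcal : ((𝒬.card : ℝ) / ((𝒬.card : ℝ) + 1)) *
        ((1 / (𝒬.card : ℝ)) * ∑ u ∈ 𝒬, R u) + 1 / ((𝒬.card : ℝ) + 1) ≤ α) :
    ((1 / (𝒬.card : ℝ)) * ∑ u ∈ 𝒬 \ 𝒦, R u ≤
      (((𝒬.card : ℝ) + 1) * α - 1 -
          (𝒦.card : ℝ) * ((1 / (𝒦.card : ℝ)) * ∑ u ∈ 𝒦, R u)) / (𝒬.card : ℝ))
    ∧
    (α ≤ 1 → 0 ≤ (1 / (𝒦.card : ℝ)) * ∑ u ∈ 𝒦, R u →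
      (((𝒬.card : ℝ) + 1) * α - 1 -
          (𝒦.card : ℝ) * ((1 / (𝒦.card : ℝ)) * ∑ u ∈ 𝒦, R u)) / (𝒬.card : ℝ) ≤
        α - ((𝒦.card : ℝ) / ((𝒬.card : ℝ) + 1)) *
          ((1 / (𝒦.card : ℝ)) * ∑ u ∈ 𝒦, R u)) := by
  have hq : (0 : ℝ) < (𝒬.card : ℝ) := by exact_mod_cast h𝒬.card_pos
  have hk : (0 : ℝ) < (𝒦.card : ℝ) := by exact_mod_cast hK
  have hsum := Finset.sum_sdiff (f := R) h𝒦
  have hS : 0 ≤ ∑ u ∈ 𝒦, R u := Finset.sum_nonneg fun u hu => (hR u (h𝒦 hu)).1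
  generalize (𝒬.card : ℝ) = q at *
  generalize (𝒦.card : ℝ) = k at *
  generalize ∑ u ∈ 𝒦, R u = S at *
  generalize ∑ u ∈ 𝒬 \ 𝒦, R u = T at *
  rw [← hsum] at hcal
  have h1 : q / (q + 1) * (1 / q * (T + S)) + 1 / (q + 1) = (T + S + 1) / (q + 1) := by
    field_simp
  have h2 : k * (1 / k * S) = S := by field_simp
  have h3 : k / (q + 1) * (1 / k * S) = S / (q + 1) := by field_simp
  rw [h1, div_le_iff₀ (by linarith)] at hcal
  rw [h2, h3]
  refine ⟨?_, fun ha _ => ?_⟩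
  · rw [one_div_mul_eq_div]
    exact div_le_div_of_nonneg_right (by linarith) hq.le
  · have h4 : S / (q + 1) ≤ S / q := div_le_div_of_nonneg_left hS hq (by linarith)
    have h5 : ((q + 1) * α - 1 - S) / q ≤ (q * α - S) / q :=
      div_le_div_of_nonneg_right (by linarith) hq.le
    have h6 : (q * α - S) / q = α - S / q := by field_simp
    linarith
end

section
/- (Corollary 1, empirical form.) Suppose 0 ≤ α ≤ 1, every adversarial user has maximal risk, i.e., R(u) = 1 for all u ∈ 𝒦, and the threshold λ satisfies the conformal calibration inequality (Q/(Q+1))·R̂ + 1/(Q+1) ≤ α. Then the average empirical risk of the non-adversarial users satisfies R̂_nonadv ≤ max{0, α − K/(Q+1)}. -/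
/-- (Corollary 1, empirical form.) If `0 ≤ α ≤ 1`, every adversarial user has
maximal risk (`R u = 1` for `u ∈ 𝒦`), and the conformal calibration inequality
holds, then `R̂_nonadv ≤ max 0 (α − K/(Q+1))`. -/
theorem nonadv_risk_le_budget_of_maximal_adversaries {U : Type*} [DecidableEq U]
    (𝒬 𝒦 : Finset U) (h𝒬 : 𝒬.Nonempty) (h𝒦 : 𝒦 ⊆ 𝒬) (hK : 0 < 𝒦.card)
    (R : U → ℝ) (hR : ∀ u ∈ 𝒬, 0 ≤ R u ∧ R u ≤ 1)
    (hadv : ∀ u ∈ 𝒦, R u = 1)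
    (α : ℝ) (hα0 : 0 ≤ α) (hα1 : α ≤ 1)
    (hcal : ((𝒬.card : ℝ) / ((𝒬.card : ℝ) + 1)) *
        ((1 / (𝒬.card : ℝ)) * ∑ u ∈ 𝒬, R u) + 1 / ((𝒬.card : ℝ) + 1) ≤ α) :
    (1 / (𝒬.card : ℝ)) * ∑ u ∈ 𝒬 \ 𝒦, R u ≤
      max 0 (α - (𝒦.card : ℝ) / ((𝒬.card : ℝ) + 1)) := by
  have hQ : (0 : ℝ) < (𝒬.card : ℝ) := by exact_mod_cast h𝒬.card_pos
  have hsplit : ∑ u ∈ 𝒬 \ 𝒦, R u + ∑ u ∈ 𝒦, R u = ∑ u ∈ 𝒬, R u :=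
    Finset.sum_sdiff h𝒦
  have hKs : ∑ u ∈ 𝒦, R u = (𝒦.card : ℝ) := by
    rw [Finset.sum_congr rfl hadv]; simp
  have hTot : ∑ u ∈ 𝒬, R u ≤ (𝒬.card : ℝ) := by
    have h := Finset.sum_le_sum (fun u hu => (hR u hu).2)
    simpa using h
  rw [hKs] at hsplit
  have hK0 : (0 : ℝ) ≤ (𝒦.card : ℝ) := Nat.cast_nonneg _
  rw [← hsplit] at hcal hTot
  generalize ∑ u ∈ 𝒬 \ 𝒦, R u = S at *
  generalize (𝒬.card : ℝ) = q at *
  generalize (𝒦.card : ℝ) = k at *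
  refine le_trans ?_ (le_max_right _ _)
  have h1 : q / (q + 1) * (1 / q * (S + k)) + 1 / (q + 1)
      = (S + 1) / (q + 1) + k / (q + 1) := by
    field_simp
    ring
  have h2 : 1 / q * S ≤ (S + 1) / (q + 1) := by
    rw [one_div_mul_eq_div, div_le_div_iff₀ hQ (by linarith)]
    nlinarith
  linarith
end
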